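/- Lower bound of the variational principle: Let (X,G) be a G-action topological dynamical system with G a countable infinite discrete amenable group, and let {F_n} be a sequence of finite subsets of G satisfying the growth condition. Then for every Borel subset Z of X, h^P_top(Z,{F_n}) ≥ sup{ h̄^loc_μ(Z,{F_n}) : μ a Borel probability measure on X with μ(Z) = 1 }. -/

import Mathlib

open Filter Set MeasureTheory ENNReal Topology
open scoped Pointwise symmDiff NNReal

namespace AmenablePacking

variable {G X Y : Type*}

/-- The open dynamical (Bowen) ball of center `x` and radius `ε` over the finite set `F`. -/
def dynBall [PseudoMetricSpace X] (act : G → X → X) (F : Finset G) (x : X) (ε : ℝ) : Set X :=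
  {y | ∀ g ∈ F, dist (act g x) (act g y) < ε}

/-- The closed dynamical (Bowen) ball of center `x` and radius `ε` over the finite set `F`. -/
def dynClosedBall [PseudoMetricSpace X] (act : G → X → X) (F : Finset G) (x : X) (ε : ℝ) :
    Set X :=
  {y | ∀ g ∈ F, dist (act g x) (act g y) ≤ ε}

/-- The packing pre-measure `P(Z, N, ε, s, {F_n})`: the supremum of `∑ᵢ exp (- s |F_{n_i}|)` over
all finite or countable pairwise disjoint families of closed Bowen balls with centers in `Z`
and indices `n_i ≥ N`. -/
noncomputable def packP [PseudoMetricSpace X] (act : G → X → X) (Fs : ℕ → Finset G) (Z : Set X)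
    (N : ℕ) (ε s : ℝ) : ℝ≥0∞ :=
  ⨆ (t : Set ℕ) (c : ℕ → X × ℕ) (_ : ∀ i ∈ t, (c i).1 ∈ Z ∧ N ≤ (c i).2)
    (_ : ∀ i ∈ t, ∀ j ∈ t, i ≠ j →
      Disjoint (dynClosedBall act (Fs (c i).2) (c i).1 ε)
        (dynClosedBall act (Fs (c j).2) (c j).1 ε)),
    ∑' i : t, ENNReal.ofReal (Real.exp (-s * ((Fs (c (i : ℕ)).2).card : ℝ)))

/-- `P(Z, ε, s, {F_n}) = lim_{N → ∞} P(Z, N, ε, s, {F_n})`; the quantity is non-increasing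
in `N`, so the limit equals the infimum. -/
noncomputable def packPLim [PseudoMetricSpace X] (act : G → X → X) (Fs : ℕ → Finset G)
    (Z : Set X) (ε s : ℝ) : ℝ≥0∞ :=
  ⨅ N : ℕ, packP act Fs Z N ε s

/-- `𝒫(Z, ε, s, {F_n})`: the countably subadditive envelope of `P(·, ε, s, {F_n})`. -/
noncomputable def packOuter [PseudoMetricSpace X] (act : G → X → X) (Fs : ℕ → Finset G)
    (Z : Set X) (ε s : ℝ) : ℝ≥0∞ :=
  ⨅ (Zs : ℕ → Set X) (_ : Z ⊆ ⋃ i, Zs i), ∑' i, packPLim act Fs (Zs i) ε s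

/-- `h^P_top(Z, ε, {F_n})`: the critical value of `s ≥ 0` at which `𝒫(Z, ε, s, {F_n})` jumps
from `+∞` to `0`. -/
noncomputable def packEntEps [PseudoMetricSpace X] (act : G → X → X) (Fs : ℕ → Finset G)
    (Z : Set X) (ε : ℝ) : ℝ≥0∞ :=
  ⨅ (s : ℝ≥0) (_ : packOuter act Fs Z ε (s : ℝ) = 0), (s : ℝ≥0∞)

/-- The amenable packing topological entropy
`h^P_top(Z, {F_n}) = lim_{ε → 0} h^P_top(Z, ε, {F_n})`. -/
noncomputable def packEnt [PseudoMetricSpace X] (act : G → X → X) (Fs : ℕ → Finset G)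
    (Z : Set X) : ℝ≥0∞ :=
  ⨆ (ε : ℝ) (_ : 0 < ε), packEntEps act Fs Z ε

/-- The Bowen pre-measure `ℳ(Z, N, ε, s, {F_n})`: the infimum of `∑ᵢ exp (- s |F_{n_i}|)` over
all finite or countable families of open Bowen balls with indices `n_i ≥ N` covering `Z`. -/
noncomputable def bowenM [PseudoMetricSpace X] (act : G → X → X) (Fs : ℕ → Finset G) (Z : Set X)
    (N : ℕ) (ε s : ℝ) : ℝ≥0∞ :=
  ⨅ (t : Set ℕ) (c : ℕ → X × ℕ) (_ : ∀ i ∈ t, N ≤ (c i).2)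
    (_ : Z ⊆ ⋃ i ∈ t, dynBall act (Fs (c i).2) (c i).1 ε),
    ∑' i : t, ENNReal.ofReal (Real.exp (-s * ((Fs (c (i : ℕ)).2).card : ℝ)))

/-- `ℳ(Z, s, {F_n}) = lim_{ε → 0} lim_{N → ∞} ℳ(Z, N, ε, s, {F_n})`. -/
noncomputable def bowenMLim [PseudoMetricSpace X] (act : G → X → X) (Fs : ℕ → Finset G)
    (Z : Set X) (s : ℝ) : ℝ≥0∞ :=
  ⨆ (ε : ℝ) (_ : 0 < ε), ⨆ N : ℕ, bowenM act Fs Z N ε s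

/-- The amenable Bowen topological entropy `h^B_top(Z, {F_n})`: the critical value of `s ≥ 0`
at which `ℳ(Z, s, {F_n})` jumps from `+∞` to `0`. -/
noncomputable def bowenEnt [PseudoMetricSpace X] (act : G → X → X) (Fs : ℕ → Finset G)
    (Z : Set X) : ℝ≥0∞ :=
  ⨅ (s : ℝ≥0) (_ : bowenMLim act Fs Z (s : ℝ) = 0), (s : ℝ≥0∞)

/-- `E` is an `(F, ε)`-separated set: distinct points are at `d_F`-distance `> ε`. -/
def IsDynSeparated [PseudoMetricSpace X] (act : G → X → X) (F : Finset G) (ε : ℝ)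
    (E : Set X) : Prop :=
  ∀ x ∈ E, ∀ y ∈ E, x ≠ y → ∃ g ∈ F, ε < dist (act g x) (act g y)

/-- `s_F(Z, ε)`: the maximal cardinality of an `(F, ε)`-separated subset of `Z`. -/
noncomputable def sepNum [PseudoMetricSpace X] (act : G → X → X) (F : Finset G) (Z : Set X)
    (ε : ℝ) : ℕ :=
  sSup {k : ℕ | ∃ E : Finset X, ↑E ⊆ Z ∧ IsDynSeparated act F ε ↑E ∧ E.card = k}

/-- The upper capacity entropy of `Z` at scale `ε`:
`limsup_n (1/|F_n|) log s_{F_n}(Z, ε)`. -/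
noncomputable def ucEntEps [PseudoMetricSpace X] (act : G → X → X) (Fs : ℕ → Finset G)
    (Z : Set X) (ε : ℝ) : ℝ≥0∞ :=
  limsup (fun n => ENNReal.ofReal (Real.log ((sepNum act (Fs n) Z ε : ℝ)) / ((Fs n).card : ℝ)))
    atTop

/-- The upper capacity topological entropy `h^{UC}_top(Z, {F_n})`. -/
noncomputable def ucEnt [PseudoMetricSpace X] (act : G → X → X) (Fs : ℕ → Finset G)
    (Z : Set X) : ℝ≥0∞ :=
  ⨆ (ε : ℝ) (_ : 0 < ε), ucEntEps act Fs Z ε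

/-- The upper local entropy `h̄^loc_μ(Z, {F_n}) =
`∫_Z lim_{ε→0} limsup_n -(1/|F_n|) log μ(B_{F_n}(x, ε)) dμ`. -/
noncomputable def upperLocalEnt [PseudoMetricSpace X] [MeasurableSpace X] (act : G → X → X)
    (Fs : ℕ → Finset G) (μ : Measure X) (Z : Set X) : ℝ≥0∞ :=
  ∫⁻ x in Z, ⨆ (ε : ℝ) (_ : 0 < ε),
    limsup (fun n =>
      ENNReal.ofReal (-Real.log ((μ (dynBall act (Fs n) x ε)).toReal) / ((Fs n).card : ℝ)))
      atTop ∂μ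

/-- A Følner sequence: a sequence of nonempty finite subsets of `G` which is asymptotically
invariant, i.e. `|g F_n ∆ F_n| / |F_n| → 0` for every `g ∈ G`. -/
def Folner [Group G] [DecidableEq G] (Fs : ℕ → Finset G) : Prop :=
  (∀ n, (Fs n).Nonempty) ∧
    ∀ g : G,
      Tendsto (fun n => ((((Fs n).image fun h => g * h) ∆ Fs n).card : ℝ) / ((Fs n).card : ℝ))
        atTop (nhds 0)

/-- A tempered sequence: `|⋃_{k < n} F_k⁻¹ F_n| ≤ C |F_n|` for a constant `C > 0`. -/
def Tempered [Group G] [DecidableEq G] (Fs : ℕ → Finset G) : Prop :=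
  ∃ C : ℝ, 0 < C ∧
    ∀ n : ℕ, ((((Finset.range n).biUnion fun k => (Fs k)⁻¹ * Fs n).card : ℝ))
      ≤ C * ((Fs n).card : ℝ)

/-- The growth condition `lim_n |F_n| / log n = +∞`. -/
def GrowthCond (Fs : ℕ → Finset G) [Group G] : Prop :=
  Tendsto (fun n => ((Fs n).card : ℝ) / Real.log (n : ℝ)) atTop atTop

/-- The static (Shannon) entropy of the finite measurable partition of `X` induced by a map
into a finite set. -/
noncomputable def partEnt [MeasurableSpace X] (μ : Measure X) {ι : Type*} [Fintype ι]
    (P : X → ι) : ℝ :=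
  ∑ i : ι, Real.negMulLog ((μ (P ⁻¹' {i})).toReal)

/-- The measure-theoretic (Kolmogorov–Sinai) entropy `h_μ(X, G)` of the action w.r.t. the
invariant measure `μ`, computed along the Følner sequence `{F_n}`: the supremum over finite
measurable partitions `P` of `lim_n (1/|F_n|) H_μ(⋁_{g ∈ F_n} (act g)⁻¹ P)`. -/
noncomputable def measEnt [MeasurableSpace X] [DecidableEq G] (act : G → X → X)
    (Fs : ℕ → Finset G) (μ : Measure X) : ℝ≥0∞ :=
  ⨆ (k : ℕ) (P : X → Fin k) (_ : Measurable P),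
    limsup (fun n => ENNReal.ofReal
      ((partEnt μ fun x (g : (Fs n : Finset G)) => P (act (g : G) x)) / ((Fs n).card : ℝ)))
      atTop

/-- The set of generic points of `μ` w.r.t. `{F_n}`. -/
def genericPoints [TopologicalSpace X] [MeasurableSpace X] (act : G → X → X)
    (Fs : ℕ → Finset G) (μ : Measure X) : Set X :=
  {x | ∀ f : C(X, ℝ),
    Tendsto (fun n => (∑ g ∈ Fs n, f (act g x)) / ((Fs n).card : ℝ)) atTop
      (nhds (∫ y, f y ∂μ))}

/-- `μ` is invariant under the action. -/
def InvariantMeasure [MeasurableSpace X] (act : G → X → X) (μ : Measure X) : Prop :=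
  ∀ (g : G) (s : Set X), MeasurableSet s → μ (act g ⁻¹' s) = μ s

/-- The action is ergodic w.r.t. `μ`: every invariant measurable set is null or conull. -/
def ErgodicAction [MeasurableSpace X] (act : G → X → X) (μ : Measure X) : Prop :=
  ∀ s : Set X, MeasurableSet s → (∀ g : G, act g ⁻¹' s = s) → μ s = 0 ∨ μ s = 1

section Packing

variable [PseudoMetricSpace X] {act : G → X → X} {F : Finset G} {Fs : ℕ → Finset G}

lemma dynBall_mono (act : G → X → X) (F : Finset G) (x : X) {ε ε' : ℝ} (h : ε ≤ ε') :
    dynBall act F x ε ⊆ dynBall act F x ε' :=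
  fun _ hy g hg => (hy g hg).trans_le h

lemma mem_dynBall_of_inter_nonempty {x y : X} {ε ε' : ℝ} (h : 2 * ε < ε')
    (hxy : (dynClosedBall act F x ε ∩ dynClosedBall act F y ε).Nonempty) :
    x ∈ dynBall act F y ε' := by
  obtain ⟨z, hx, hy⟩ := hxy
  intro g hg
  have h1 := hx g hg
  have h2 := hy g hg
  have h3 := dist_triangle_right (act g y) (act g x) (act g z)
  linarith

lemma isOpen_dynBall (hact : ∀ g, Continuous (act g)) (F : Finset G) (x : X) (ε : ℝ) :
    IsOpen (dynBall act F x ε) := by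
  have : dynBall act F x ε = ⋂ g ∈ F, {y | dist (act g x) (act g y) < ε} := by
    ext y
    simp [dynBall]
  rw [this]
  exact isOpen_biInter_finset fun g _ =>
    isOpen_lt (continuous_const.dist (hact g)) continuous_const

lemma mem_dynBall_self (act : G → X → X) (F : Finset G) (x : X) {ε : ℝ} (hε : 0 < ε) :
    x ∈ dynBall act F x ε :=
  fun g _ => by simpa using hε

lemma dynBall_subset_dynClosedBall (act : G → X → X) (F : Finset G) (x : X) (ε : ℝ) :
    dynBall act F x ε ⊆ dynClosedBall act F x ε :=
  fun _ hy g hg => (hy g hg).le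

lemma packP_mono {Z Z' : Set X} {N N' : ℕ} (hZ : Z ⊆ Z') (hN : N' ≤ N) (ε s : ℝ) :
    packP act Fs Z N ε s ≤ packP act Fs Z' N' ε s := by
  refine iSup_mono fun t => iSup_mono fun c => ?_
  exact iSup_le fun h => le_iSup_of_le
    (fun i hi => ⟨hZ (h i hi).1, hN.trans (h i hi).2⟩) le_rfl

/-- A countable family of pairwise disjoint closed Bowen balls of the same index is admissible
in the packing pre-measure. -/
lemma tsum_le_packP {T Z : Set X} (hT : T.Countable) (hTZ : T ⊆ Z) {N n : ℕ} (hn : N ≤ n)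
    {ε : ℝ} (hdisj : T.PairwiseDisjoint fun x => dynClosedBall act (Fs n) x ε) (s : ℝ) :
    ∑' _ : T, ENNReal.ofReal (Real.exp (-s * ((Fs n).card : ℝ))) ≤ packP act Fs Z N ε s := by
  obtain rfl | ⟨x₀, _⟩ := T.eq_empty_or_nonempty
  · simp
  have := hT.to_subtype
  obtain ⟨e, he⟩ := exists_injective_nat T
  let c : ℕ → X × ℕ := fun i => (Function.extend e (fun x : T => (x : X)) (fun _ => x₀) i, n)
  have hc : ∀ x : T, c (e x) = ((x : X), n) := fun x => by
    simp [c, he.extend_apply]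
  have hcard : ∑' _ : T, ENNReal.ofReal (Real.exp (-s * ((Fs n).card : ℝ))) =
      ∑' i : range e, ENNReal.ofReal (Real.exp (-s * ((Fs (c (i : ℕ)).2).card : ℝ))) :=
    (Equiv.ofInjective e he).tsum_eq
      fun _ : range e => ENNReal.ofReal (Real.exp (-s * ((Fs n).card : ℝ)))
  rw [hcard]
  refine le_iSup_of_le (range e) (le_iSup_of_le c (le_iSup_of_le ?_ (le_iSup_of_le ?_ le_rfl)))
  · rintro _ ⟨x, rfl⟩
    rw [hc]
    exact ⟨hTZ x.2, hn⟩
  · rintro _ ⟨x, rfl⟩ _ ⟨y, rfl⟩ hxy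
    rw [hc, hc]
    exact hdisj x.2 y.2 fun h => hxy (congrArg e (Subtype.ext h))

variable [SecondCountableTopology X] [MeasurableSpace X]

/-- If all Bowen balls of radius `ε'` centered in `E` have measure at most `exp (-s |F_n|)`, then
a maximal packing of `E` by balls of radius `ε < ε' / 2` controls the measure of `E`. -/
lemma measure_le_exp_mul_packP (hact : ∀ g, Continuous (act g)) (μ : Measure X) {E : Set X}
    {N n : ℕ} (hn : N ≤ n) {ε ε' r s : ℝ} (hε : 0 < ε) (hεε' : 2 * ε < ε')
    (hE : ∀ x ∈ E,
      μ (dynBall act (Fs n) x ε') ≤ ENNReal.ofReal (Real.exp (-s * ((Fs n).card : ℝ)))) :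
    μ E ≤ ENNReal.ofReal (Real.exp (-(s - r) * ((Fs n).card : ℝ))) * packP act Fs E N ε r := by
  obtain ⟨T, hTE, hdisj, hcover⟩ := Vitali.exists_disjoint_subfamily_covering_enlargement
    (fun x => dynClosedBall act (Fs n) x ε) E (fun _ => (1 : ℝ)) 2 (by norm_num)
    (fun _ _ => zero_le_one) 1 (fun _ _ => le_rfl)
    (fun x _ => ⟨x, dynBall_subset_dynClosedBall _ _ _ _ (mem_dynBall_self _ _ _ hε)⟩)
  have hT : T.Countable := by
    refine Set.PairwiseDisjoint.countable_of_isOpen (s := fun x => dynBall act (Fs n) x ε)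
      (fun x hx y hy hxy => ?_) (fun x _ => isOpen_dynBall hact _ _ _)
      (fun x _ => ⟨x, mem_dynBall_self _ _ _ hε⟩)
    exact (hdisj hx hy hxy).mono (dynBall_subset_dynClosedBall _ _ _ _)
      (dynBall_subset_dynClosedBall _ _ _ _)
  have hsub : E ⊆ ⋃ x ∈ T, dynBall act (Fs n) x ε' := fun x hx => by
    obtain ⟨y, hy, hxy, -⟩ := hcover x hx
    exact mem_biUnion hy (mem_dynBall_of_inter_nonempty hεε' hxy)
  calc μ E ≤ ∑' x : T, μ (dynBall act (Fs n) x ε') :=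
        (measure_mono hsub).trans (measure_biUnion_le μ hT _)
    _ ≤ ∑' _ : T, ENNReal.ofReal (Real.exp (-(s - r) * ((Fs n).card : ℝ))) *
          ENNReal.ofReal (Real.exp (-r * ((Fs n).card : ℝ))) := by
        refine ENNReal.tsum_le_tsum fun x => (hE x (hTE x.2)).trans_eq ?_
        rw [← ENNReal.ofReal_mul (Real.exp_pos _).le, ← Real.exp_add]
        ring_nf
    _ = ENNReal.ofReal (Real.exp (-(s - r) * ((Fs n).card : ℝ))) *
          ∑' _ : T, ENNReal.ofReal (Real.exp (-r * ((Fs n).card : ℝ))) := ENNReal.tsum_mul_left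
    _ ≤ _ := by
        gcongr
        exact tsum_le_packP hT hTE hn hdisj r

end Packing

lemma GrowthCond.summable_exp [Group G] {Fs : ℕ → Finset G} (h : GrowthCond Fs) {δ : ℝ}
    (hδ : 0 < δ) : Summable fun n => Real.exp (-δ * ((Fs n).card : ℝ)) := by
  refine summable_of_isBigO_nat (g := fun n : ℕ => 1 / (n : ℝ) ^ 2)
    (Real.summable_one_div_nat_pow.2 one_lt_two) (Asymptotics.IsBigO.of_bound 1 ?_)
  filter_upwards [h.eventually_ge_atTop (2 / δ), eventually_ge_atTop 2] with n hn hn2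
  have hn1 : (1 : ℝ) < n := by exact_mod_cast hn2
  have hlog := Real.log_pos hn1
  rw [div_le_div_iff₀ hδ hlog] at hn
  rw [Real.norm_of_nonneg (Real.exp_pos _).le, Real.norm_of_nonneg (by positivity), one_mul,
    ← Real.le_log_iff_exp_le (by positivity), one_div, Real.log_inv, Real.log_pow]
  push_cast
  linarith

section Measure

variable [Group G] [PseudoMetricSpace X] [SecondCountableTopology X] [MeasurableSpace X]
  {act : G → X → X} {Fs : ℕ → Finset G}

/-- A set of positive measure along which the Bowen balls infinitely often have measure at most
`exp (-s |F_n|)` has packing pre-measure at least `1` for every exponent `r < s`. -/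
lemma one_le_packPLim (hact : ∀ g, Continuous (act g)) (hgrow : GrowthCond Fs) (μ : Measure X)
    {E : Set X} (hμE : μ E ≠ 0) {ε ε' r s : ℝ} (hε : 0 < ε) (hεε' : 2 * ε < ε') (hrs : r < s)
    (hE : ∀ x ∈ E, ∃ᶠ n in atTop,
      μ (dynBall act (Fs n) x ε') ≤ ENNReal.ofReal (Real.exp (-s * ((Fs n).card : ℝ)))) :
    1 ≤ packPLim act Fs E ε r := by
  refine le_iInf fun N => ?_
  by_contra! hlt
  set a : ℕ → ℝ≥0∞ := fun n => ENNReal.ofReal (Real.exp (-(s - r) * ((Fs n).card : ℝ)))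
  have ha : ∑' n, a n ≠ ∞ := (hgrow.summable_exp (sub_pos.2 hrs)).tsum_ofReal_ne_top
  have hbound : ∀ M ≥ N, μ E ≤ ∑' n, a (n + M) := fun M hM => by
    let A : ℕ → Set X := fun n => {x ∈ E | μ (dynBall act (Fs n) x ε') ≤
      ENNReal.ofReal (Real.exp (-s * ((Fs n).card : ℝ)))}
    have hsub : E ⊆ ⋃ n, A (n + M) := fun x hx => by
      obtain ⟨n, hn, hxn⟩ := (frequently_atTop.1 (hE x hx)) M
      refine mem_iUnion.2 ⟨n - M, ?_⟩
      rw [Nat.sub_add_cancel hn]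
      exact ⟨hx, hxn⟩
    refine (measure_mono hsub).trans ((measure_iUnion_le _).trans
      (ENNReal.tsum_le_tsum fun n => ?_))
    calc μ (A (n + M)) ≤ a (n + M) * packP act Fs (A (n + M)) N ε r :=
          measure_le_exp_mul_packP hact μ (hM.trans (Nat.le_add_left _ _)) hε hεε'
            fun x hx => hx.2
      _ ≤ a (n + M) * 1 := by
          gcongr
          exact (packP_mono (sep_subset _ _) le_rfl ε r).trans hlt.le
      _ = a (n + M) := mul_one _
  have hlim := ENNReal.tendsto_sum_nat_add a ha
  exact hμE (nonpos_iff_eq_zero.1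
    (ge_of_tendsto hlim ((eventually_ge_atTop N).mono hbound)))

lemma measure_eq_zero_of_packOuter_eq_zero (hact : ∀ g, Continuous (act g))
    (hgrow : GrowthCond Fs) (μ : Measure X) {Z : Set X} {ε ε' r s : ℝ} (hε : 0 < ε)
    (hεε' : 2 * ε < ε') (hrs : r < s) (hZ : packOuter act Fs Z ε r = 0) :
    μ {x ∈ Z | ∃ᶠ n in atTop, μ (dynBall act (Fs n) x ε') ≤
      ENNReal.ofReal (Real.exp (-s * ((Fs n).card : ℝ)))} = 0 := by
  obtain ⟨Zs, hZs, hsum⟩ : ∃ Zs : ℕ → Set X, Z ⊆ ⋃ i, Zs i ∧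
      ∑' i, packPLim act Fs (Zs i) ε r < 1 := by
    have : packOuter act Fs Z ε r < 1 := hZ ▸ zero_lt_one
    simpa only [packOuter, iInf_lt_iff, exists_prop] using this
  set A := {x ∈ Z | ∃ᶠ n in atTop, μ (dynBall act (Fs n) x ε') ≤
      ENNReal.ofReal (Real.exp (-s * ((Fs n).card : ℝ)))}
  have hA : A ⊆ ⋃ i, A ∩ Zs i := by
    rw [← inter_iUnion]
    exact subset_inter subset_rfl ((sep_subset _ _).trans hZs)
  refine measure_mono_null hA (measure_iUnion_null fun i => ?_)
  by_contra hi
  refine hsum.not_ge ?_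
  calc (1 : ℝ≥0∞) ≤ packPLim act Fs (A ∩ Zs i) ε r :=
        one_le_packPLim hact hgrow μ hi hε hεε' hrs fun x hx => hx.1.2
    _ ≤ packPLim act Fs (Zs i) ε r :=
        iInf_mono fun _ => packP_mono inter_subset_right le_rfl ε r
    _ ≤ _ := ENNReal.le_tsum i

end Measure

lemma le_exp_of_lt_ofReal_neg_log_div {m : ℝ≥0∞} (hm : m ≠ ∞) {s : ℝ≥0} {k : ℝ} (hk : 0 < k)
    (h : (s : ℝ≥0∞) < ENNReal.ofReal (-Real.log m.toReal / k)) :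
    m ≤ ENNReal.ofReal (Real.exp (-s * k)) := by
  rw [ENNReal.le_ofReal_iff_toReal_le hm (Real.exp_pos _).le]
  rw [ENNReal.lt_ofReal_iff_toReal_lt ENNReal.coe_ne_top, ENNReal.coe_toReal,
    lt_div_iff₀ hk] at h
  refine (Real.le_exp_log _).trans (Real.exp_le_exp.2 ?_)
  linarith

theorem packing_entropy_variational_principle_lower_bound
    [Group G] [Countable G] [Infinite G] [DecidableEq G]
    [MetricSpace X] [CompactSpace X] [MeasurableSpace X] [BorelSpace X]
    (act : G → X → X)
    (hact_one : ∀ x, act 1 x = x)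
    (hact_mul : ∀ g h x, act (g * h) x = act g (act h x))
    (hact_cont : ∀ g : G, Continuous (act g))
    (hamen : ∃ E : ℕ → Finset G, Folner E)
    (Fs : ℕ → Finset G) (hne : ∀ n, (Fs n).Nonempty) (hgrow : GrowthCond Fs)
    (Z : Set X) (hZmeas : MeasurableSet Z) :
    (⨆ (μ : Measure X) (_ : IsProbabilityMeasure μ) (_ : μ Z = 1),
        upperLocalEnt act Fs μ Z) ≤ packEnt act Fs Z := by
  refine iSup_le fun μ => iSup_le fun _ => iSup_le fun hμZ => ?_
  refine le_of_forall_gt_imp_ge_of_dense fun a ha => ?_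
  obtain ⟨s, hps, hsa⟩ := ENNReal.lt_iff_exists_nnreal_btwn.1 ha
  refine le_trans ?_ hsa.le
  let A : ℝ → Set X := fun ε => {x ∈ Z | ∃ᶠ n in atTop, μ (dynBall act (Fs n) x ε) ≤
    ENNReal.ofReal (Real.exp (-s * ((Fs n).card : ℝ)))}
  have hA : ∀ ε, 0 < ε → μ (A ε) = 0 := fun ε hε => by
    have hlt : packEntEps act Fs Z (ε / 3) < s :=
      (le_iSup₂ (f := fun ε (_ : 0 < ε) => packEntEps act Fs Z ε) (ε / 3)
        (by positivity)).trans_lt hps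
    simp only [packEntEps, iInf_lt_iff] at hlt
    obtain ⟨r, hr, hrs⟩ := hlt
    exact measure_eq_zero_of_packOuter_eq_zero hact_cont hgrow μ (by positivity) (by linarith)
      (by exact_mod_cast hrs) hr
  have hnull : μ (⋃ k : ℕ, A (1 / (k + 1))) = 0 :=
    measure_iUnion_null fun k => hA _ Nat.one_div_pos_of_nat
  have hae : ∀ᵐ x ∂μ.restrict Z, (⨆ (ε : ℝ) (_ : 0 < ε), limsup (fun n => ENNReal.ofReal
      (-Real.log ((μ (dynBall act (Fs n) x ε)).toReal) / ((Fs n).card : ℝ))) atTop) ≤ s := by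
    rw [ae_restrict_iff' hZmeas]
    filter_upwards [measure_eq_zero_iff_ae_notMem.1 hnull] with x hx hxZ
    refine iSup₂_le fun ε hε => ?_
    by_contra! hlt
    obtain ⟨k, hk⟩ := exists_nat_one_div_lt hε
    refine hx (mem_iUnion.2 ⟨k, hxZ, (frequently_lt_of_lt_limsup (by isBoundedDefault) hlt).mono
      fun n hn => ?_⟩)
    exact (measure_mono (dynBall_mono act (Fs n) x hk.le)).trans
      (le_exp_of_lt_ofReal_neg_log_div (measure_ne_top _ _)
        (Nat.cast_pos.2 (hne n).card_pos) hn)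
  calc upperLocalEnt act Fs μ Z ≤ ∫⁻ _ in Z, (s : ℝ≥0∞) ∂μ := lintegral_mono_ae hae
    _ = s := by simp [hμZ]

end AmenablePacking
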